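/- Let n, m ≥ 1, α ∈ (0,1), β ≥ 0. There exists a constant C_H > 0 such that for every u ∈ C_c^∞(ℝ^{n+m}), ∫_{ℝ^{n+m}} |u(x,y)| / |x|^{1−α} dx dy ≤ C_H ∫_{ℝ^{n+m}} |∇_L u(x,y)| dx dy (Hardy-type inequality). -/

import Mathlib

open MeasureTheory

/-- The pointwise norm of the Grushin gradient
`∇_L f = (|x|^α ∇_x f, |x|^β ∇_y f)` of `f : ℝⁿ × ℝᵐ → ℝ`,
i.e. `|∇_L f(x,y)|² = |x|^{2α} |∇_x f|² + |x|^{2β} |∇_y f|²`. -/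
noncomputable def gradLNorm (n m : ℕ) (α β : ℝ)
    (f : EuclideanSpace ℝ (Fin n) × EuclideanSpace ℝ (Fin m) → ℝ)
    (ξ : EuclideanSpace ℝ (Fin n) × EuclideanSpace ℝ (Fin m)) : ℝ :=
  Real.sqrt (‖ξ.1‖ ^ (2 * α) * ‖gradient (fun x => f (x, ξ.2)) ξ.1‖ ^ 2
    + ‖ξ.1‖ ^ (2 * β) * ‖gradient (fun y => f (ξ.1, y)) ξ.2‖ ^ 2)

/-- The homogeneous dimension `Q = (n + m(β+1−α))/(1−α)`. -/
noncomputable def homDim (n m : ℕ) (α β : ℝ) : ℝ :=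
  (n + m * (β + 1 - α)) / (1 - α)

open Module
open scoped ENNReal

/-- Scaling of lower Lebesgue integrals against an additive Haar measure. -/
theorem lintegral_comp_smul_addHaar {E : Type*} [NormedAddCommGroup E] [NormedSpace ℝ E]
    [FiniteDimensional ℝ E] [MeasurableSpace E] [BorelSpace E] (μ : Measure E)
    [μ.IsAddHaarMeasure] {f : E → ℝ≥0∞} (hf : Measurable f) {r : ℝ} (hr : r ≠ 0) :
    ∫⁻ x, f (r • x) ∂μ = ENNReal.ofReal |(r ^ finrank ℝ E)⁻¹| * ∫⁻ x, f x ∂μ := by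
  rw [← lintegral_map hf (measurable_const_smul r), Measure.map_addHaar_smul μ hr,
    lintegral_smul_measure, smul_eq_mul]

theorem lintegral_Iic_neg_rpow {p : ℝ} (hp : p < -1) :
    ∫⁻ t in Set.Iic (-1 : ℝ), ENNReal.ofReal ((-t) ^ p) = ENNReal.ofReal (-(p + 1)⁻¹) := by
  have hval : ∫ t in Set.Iic (-1 : ℝ), (-t) ^ p = -(p + 1)⁻¹ := by
    rw [integral_comp_neg_Iic (-1) fun s : ℝ => s ^ p, neg_neg,
      integral_Ioi_rpow_of_lt hp one_pos, Real.one_rpow, neg_div, one_div]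
  have hpos : 0 < -(p + 1)⁻¹ := neg_pos.2 (inv_lt_zero.2 (by linarith))
  rw [← hval, ofReal_integral_eq_lintegral_ofReal]
  · by_contra h
    rw [integral_undef h] at hval
    exact hpos.ne hval
  · filter_upwards [ae_restrict_mem measurableSet_Iic] with t ht
    have : t ≤ -1 := ht
    exact Real.rpow_nonneg (by linarith) p

section Hardy

variable {E : Type*} [NormedAddCommGroup E] [NormedSpace ℝ E]

/-- Integrating the derivative of `f` along the ray from `x` to infinity. -/
theorem enorm_le_lintegral_fderiv_ray [FiniteDimensional ℝ E] {f : E → ℝ} (hf : ContDiff ℝ 1 f)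
    (hs : HasCompactSupport f) {x : E} (hx : x ≠ 0) :
    ‖f x‖ₑ ≤ ∫⁻ t in Set.Iic (-1 : ℝ), ‖fderiv ℝ f ((-t) • x)‖ₑ * ‖x‖ₑ := by
  have hemb : Topology.IsClosedEmbedding fun t : ℝ => (-t) • x :=
    (isClosedEmbedding_smul_left hx).comp (Homeomorph.neg ℝ).isClosedEmbedding
  have hg : ContDiff ℝ 1 fun t : ℝ => f ((-t) • x) :=
    hf.comp (contDiff_neg.smul contDiff_const)
  have hgs : HasCompactSupport fun t : ℝ => f ((-t) • x) := hs.comp_isClosedEmbedding hemb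
  calc ‖f x‖ₑ = ‖f ((-(-1 : ℝ)) • x)‖ₑ := by simp
    _ ≤ ∫⁻ t in Set.Iic (-1 : ℝ), ‖deriv (fun t : ℝ => f ((-t) • x)) t‖ₑ :=
      hgs.enorm_le_lintegral_Ici_deriv hg (-1)
    _ ≤ _ := by
      refine lintegral_mono fun t => ?_
      have h1 : HasDerivAt (fun t : ℝ => (-t) • x) (-x) t := by
        simpa using (hasDerivAt_neg t).smul_const x
      have h2 := ((hf.differentiable one_ne_zero) ((-t) • x)).hasFDerivAt.comp_hasDerivAt t h1
      rw [show deriv (fun t : ℝ => f ((-t) • x)) t = _ from h2.deriv]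
      simpa using (fderiv ℝ f ((-t) • x)).le_opENorm (-x)

/-- The weighted `L¹` Hardy inequality on a finite-dimensional normed space. -/
theorem lintegral_hardy [FiniteDimensional ℝ E] [MeasurableSpace E] [BorelSpace E]
    (μ : Measure E) [μ.IsAddHaarMeasure] {α : ℝ} (hα : 0 < α) (hα1 : α < 1)
    (hd : 1 < α + finrank ℝ E)
    {f : E → ℝ} (hf : ContDiff ℝ 1 f) (hs : HasCompactSupport f) :
    ∫⁻ x, ENNReal.ofReal (|f x| / ‖x‖ ^ (1 - α)) ∂μ ≤
      ENNReal.ofReal (α + finrank ℝ E - 1)⁻¹ *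
        ∫⁻ x, ENNReal.ofReal (‖x‖ ^ α * ‖fderiv ℝ f x‖) ∂μ := by
  have hcf : Continuous (fderiv ℝ f) := hf.continuous_fderiv one_ne_zero
  have hpow : Continuous fun x : E => ‖x‖ ^ α := continuous_norm.rpow_const fun _ => .inr hα.le
  set G : E → ℝ≥0∞ := fun x => ENNReal.ofReal (‖x‖ ^ α * ‖fderiv ℝ f x‖) with hG
  have hGm : Measurable G := (ENNReal.continuous_ofReal.comp (hpow.mul hcf.norm)).measurable
  calc ∫⁻ x, ENNReal.ofReal (|f x| / ‖x‖ ^ (1 - α)) ∂μ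
      ≤ ∫⁻ x, (∫⁻ t in Set.Iic (-1 : ℝ),
          ENNReal.ofReal (‖x‖ ^ α * ‖fderiv ℝ f ((-t) • x)‖)) ∂μ := by
        refine lintegral_mono fun x => ?_
        rcases eq_or_ne x 0 with rfl | hx
        · simp [Real.zero_rpow (sub_pos.2 hα1).ne']
        have hx' : 0 < ‖x‖ := norm_pos_iff.2 hx
        calc ENNReal.ofReal (|f x| / ‖x‖ ^ (1 - α))
            = ENNReal.ofReal (‖x‖ ^ (1 - α))⁻¹ * ‖f x‖ₑ := by
              rw [← ofReal_norm, ← ENNReal.ofReal_mul (by positivity), Real.norm_eq_abs,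
                div_eq_inv_mul]
          _ ≤ ENNReal.ofReal (‖x‖ ^ (1 - α))⁻¹ *
              ∫⁻ t in Set.Iic (-1 : ℝ), ‖fderiv ℝ f ((-t) • x)‖ₑ * ‖x‖ₑ := by
              gcongr
              exact enorm_le_lintegral_fderiv_ray hf hs hx
          _ = _ := by
              rw [← lintegral_const_mul' _ _ ENNReal.ofReal_ne_top]
              refine lintegral_congr fun t => ?_
              rw [← ofReal_norm, ← ofReal_norm, ← ENNReal.ofReal_mul (by positivity),
                ← ENNReal.ofReal_mul (by positivity)]
              congr 1
              rw [Real.rpow_sub hx', Real.rpow_one]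
              field_simp
    _ = ∫⁻ t in Set.Iic (-1 : ℝ), ∫⁻ x,
          ENNReal.ofReal (‖x‖ ^ α * ‖fderiv ℝ f ((-t) • x)‖) ∂μ := by
        refine lintegral_lintegral_swap (Continuous.aemeasurable ?_)
        refine ENNReal.continuous_ofReal.comp ((hpow.comp continuous_fst).mul
          (hcf.comp ?_).norm)
        exact continuous_snd.neg.smul continuous_fst
    _ = ∫⁻ t in Set.Iic (-1 : ℝ),
          ENNReal.ofReal ((-t) ^ (-(α + finrank ℝ E))) * ∫⁻ x, G x ∂μ := by
        refine setLIntegral_congr_fun measurableSet_Iic fun t ht => ?_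
        have ht0 : 0 < -t := by
          have : t ≤ -1 := ht
          linarith
        have hpt : ∀ x : E, ENNReal.ofReal (‖x‖ ^ α * ‖fderiv ℝ f ((-t) • x)‖) =
            ENNReal.ofReal ((-t) ^ (-α)) * G ((-t) • x) := by
          intro x
          rw [hG, ← ENNReal.ofReal_mul (by positivity), norm_smul, Real.norm_of_nonneg ht0.le,
            Real.mul_rpow ht0.le (norm_nonneg x), Real.rpow_neg ht0.le]
          congr 1
          have : (-t) ^ α ≠ 0 := (Real.rpow_pos_of_pos ht0 α).ne'
          field_simp
        simp_rw [hpt]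
        rw [lintegral_const_mul' _ _ ENNReal.ofReal_ne_top,
          lintegral_comp_smul_addHaar μ hGm ht0.ne', ← mul_assoc,
          ← ENNReal.ofReal_mul (by positivity), abs_of_pos (by positivity), neg_add,
          Real.rpow_add ht0, Real.rpow_neg ht0.le (finrank ℝ E : ℝ), Real.rpow_natCast]
    _ = ENNReal.ofReal (α + finrank ℝ E - 1)⁻¹ * ∫⁻ x, G x ∂μ := by
        rw [lintegral_mul_const _ (by fun_prop), lintegral_Iic_neg_rpow (by linarith)]
        congr 2
        rw [← inv_neg]
        congr 1
        ring

end Hardy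

section Grushin

variable {n m : ℕ} {α β : ℝ}
  {u : EuclideanSpace ℝ (Fin n) × EuclideanSpace ℝ (Fin m) → ℝ}

theorem norm_gradient {F : Type*} [NormedAddCommGroup F] [InnerProductSpace ℝ F] [CompleteSpace F]
    (f : F → ℝ) (x : F) : ‖gradient f x‖ = ‖fderiv ℝ f x‖ := by
  simp [gradient]

theorem rpow_mul_norm_fderiv_le_gradLNorm
    (ξ : EuclideanSpace ℝ (Fin n) × EuclideanSpace ℝ (Fin m)) :
    ‖ξ.1‖ ^ α * ‖fderiv ℝ (fun x => u (x, ξ.2)) ξ.1‖ ≤ gradLNorm n m α β u ξ := by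
  refine Real.le_sqrt_of_sq_le ?_
  rw [norm_gradient, mul_pow, ← Real.rpow_mul_natCast (norm_nonneg _), mul_comm α]
  have : 0 ≤ ‖ξ.1‖ ^ (2 * β) * ‖gradient (fun y => u (ξ.1, y)) ξ.2‖ ^ 2 := by positivity
  simpa using this

theorem gradLNorm_eq_fderiv (hu : Differentiable ℝ u)
    (ξ : EuclideanSpace ℝ (Fin n) × EuclideanSpace ℝ (Fin m)) :
    gradLNorm n m α β u ξ =
      √(‖ξ.1‖ ^ (2 * α) * ‖(fderiv ℝ u ξ).comp (.inl ℝ _ _)‖ ^ 2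
        + ‖ξ.1‖ ^ (2 * β) * ‖(fderiv ℝ u ξ).comp (.inr ℝ _ _)‖ ^ 2) := by
  have h1 : HasFDerivAt (fun x => u (x, ξ.2)) ((fderiv ℝ u ξ).comp (.inl ℝ _ _)) ξ.1 :=
    (hu ξ).hasFDerivAt.comp ξ.1 (hasFDerivAt_prodMk_left ξ.1 ξ.2)
  have h2 : HasFDerivAt (fun y => u (ξ.1, y)) ((fderiv ℝ u ξ).comp (.inr ℝ _ _)) ξ.2 :=
    (hu ξ).hasFDerivAt.comp ξ.2 (hasFDerivAt_prodMk_right ξ.1 ξ.2)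
  rw [gradLNorm, norm_gradient, norm_gradient, h1.fderiv, h2.fderiv]

theorem integrable_gradLNorm (hα : 0 ≤ α) (hβ : 0 ≤ β) (hu : ContDiff ℝ 1 u)
    (hs : HasCompactSupport u) : Integrable (gradLNorm n m α β u) := by
  have hd := hu.differentiable one_ne_zero
  have hc : Continuous (fderiv ℝ u) := hu.continuous_fderiv one_ne_zero
  refine Continuous.integrable_of_hasCompactSupport ?_ ?_
  · rw [funext (gradLNorm_eq_fderiv hd)]
    have hp : ∀ {γ : ℝ}, 0 ≤ γ → Continuous
        fun ξ : EuclideanSpace ℝ (Fin n) × EuclideanSpace ℝ (Fin m) => ‖ξ.1‖ ^ (2 * γ) :=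
      fun hγ => continuous_fst.norm.rpow_const fun _ => .inr (by linarith)
    exact (((hp hα).mul ((hc.clm_comp continuous_const).norm.pow 2)).add
      ((hp hβ).mul ((hc.clm_comp continuous_const).norm.pow 2))).sqrt
  · refine (hs.fderiv (𝕜 := ℝ)).mono' fun ξ hξ => subset_tsupport _ fun h0 => hξ ?_
    rw [gradLNorm_eq_fderiv hd, h0]
    simp

end Grushin

/-- Hardy-type inequality: `∫ |u|/|x|^{1−α} ≤ C_H ∫ |∇_L u|`. -/
theorem hardy_ineq (n m : ℕ) (hn : 1 ≤ n) (hm : 1 ≤ m) (α β : ℝ)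
    (hα : α ∈ Set.Ioo (0 : ℝ) 1) (hβ : 0 ≤ β) :
    ∃ C_H : ℝ, 0 < C_H ∧
      ∀ u : EuclideanSpace ℝ (Fin n) × EuclideanSpace ℝ (Fin m) → ℝ,
        ContDiff ℝ (⊤ : ℕ∞) u → HasCompactSupport u →
        ∫ ξ, |u ξ| / ‖ξ.1‖ ^ (1 - α) ≤ C_H * ∫ ξ, gradLNorm n m α β u ξ := by
  have hn' : (1 : ℝ) ≤ n := by exact_mod_cast hn
  have hα0 : 0 < α := hα.1
  have hC : 0 < (α + n - 1)⁻¹ := inv_pos.2 (by linarith)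
  refine ⟨(α + n - 1)⁻¹, hC, fun u hu hs => ?_⟩
  have hu1 : ContDiff ℝ 1 u := hu.of_le (by exact_mod_cast le_top)
  have hint := integrable_gradLNorm (α := α) (β := β) hα0.le hβ hu1 hs
  have hnonneg : ∀ ξ, 0 ≤ gradLNorm n m α β u ξ := fun ξ => Real.sqrt_nonneg _
  have hmeas : Measurable fun ξ => |u ξ| / ‖ξ.1‖ ^ (1 - α) := by
    have := hu.continuous.measurable
    fun_prop
  have hmeasG : AEMeasurable fun ξ => ENNReal.ofReal (gradLNorm n m α β u ξ) :=
    hint.aemeasurable.ennreal_ofReal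
  rw [integral_eq_lintegral_of_nonneg_ae (.of_forall fun ξ => by positivity)
    hmeas.aestronglyMeasurable]
  refine ENNReal.toReal_le_of_le_ofReal (mul_nonneg hC.le (integral_nonneg hnonneg)) ?_
  rw [ENNReal.ofReal_mul hC.le, ofReal_integral_eq_lintegral_ofReal hint (.of_forall hnonneg),
    Measure.volume_eq_prod, lintegral_prod_symm _ hmeas.ennreal_ofReal.aemeasurable,
    lintegral_prod_symm _ hmeasG, ← lintegral_const_mul' _ _ ENNReal.ofReal_ne_top]
  refine lintegral_mono fun y => ?_
  have hslice : ContDiff ℝ 1 fun x => u (x, y) := hu1.comp (contDiff_id.prodMk contDiff_const)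
  have hsslice : HasCompactSupport fun x => u (x, y) :=
    hs.comp_isClosedEmbedding <|
      Function.LeftInverse.isClosedEmbedding (f := Prod.fst) (fun _ => rfl) continuous_fst
        (.prodMk_left y)
  refine (lintegral_hardy volume hα0 hα.2 (by simpa using by linarith) hslice hsslice).trans ?_
  simp only [finrank_euclideanSpace, Fintype.card_fin]
  gcongr with x
  exact rpow_mul_norm_fderiv_le_gradLNorm (x, y)
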